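/- Causal states are conditionally independent at different times (the causal-state process is Markov): for every k ≥ 1, the random vector (S_{−1}, S_{−2}, …, S_{−k}) and S_1 are conditionally independent given S_0; equivalently, H[S_1 | S_0, S_{−1}, …, S_{−k}] = H[S_1 | S_0]. -/

import Mathlib

open MeasureTheory ProbabilityTheory

noncomputable section

/-- Shannon entropy (in bits) of a random variable `U`. -/
def ent {Ω S : Type*} [MeasurableSpace Ω] (μ : Measure Ω) (U : Ω → S) : ℝ :=
  ∑' s : S, -((μ (U ⁻¹' {s})).toReal * Real.logb 2 (μ (U ⁻¹' {s})).toReal)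

/-- The entropy series of `U` is summable (i.e. `U` has finite entropy). -/
def entSummable {Ω S : Type*} [MeasurableSpace Ω] (μ : Measure Ω) (U : Ω → S) : Prop :=
  Summable (fun s : S => -((μ (U ⁻¹' {s})).toReal * Real.logb 2 (μ (U ⁻¹' {s})).toReal))

/-- Conditional Shannon entropy (in bits) H[U|V]. -/
def condEnt {Ω S T : Type*} [MeasurableSpace Ω] (μ : Measure Ω) (U : Ω → S) (V : Ω → T) : ℝ :=
  ent μ (fun ω => (U ω, V ω)) - ent μ V

/-- Mutual information (in bits) I[U;V]. -/
def mutInf {Ω S T : Type*} [MeasurableSpace Ω] (μ : Measure Ω) (U : Ω → S) (V : Ω → T) : ℝ :=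
  ent μ U + ent μ V - ent μ (fun ω => (U ω, V ω))

variable (A : Type*) [Fintype A] [MeasurableSpace A] [MeasurableSingletonClass A]

/-- The left shift on bi-infinite sequences. -/
def shift : (ℤ → A) → (ℤ → A) := fun ω t => ω (t + 1)

/-- The infinite future `(ω_0, ω_1, …)`. -/
def Future : (ℤ → A) → (ℕ → A) := fun ω n => ω (n : ℤ)

/-- The length-`L` future block `(X_0, …, X_{L-1})`. -/
def FutureBlk (L : ℕ) : (ℤ → A) → (Fin L → A) := fun ω i => ω ((i : ℕ) : ℤ)

/-- The length-`M` past block `(X_{-M}, …, X_{-1})`. -/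
def PastBlk (M : ℕ) : (ℤ → A) → (Fin M → A) := fun ω i => ω (((i : ℕ) : ℤ) - (M : ℤ))

/-- The infinite past at time `t`: `(ω_{t-1}, ω_{t-2}, …)`. -/
def PastAt (t : ℤ) : (ℤ → A) → (ℕ → A) := fun ω n => ω (t - 1 - (n : ℤ))

/-- The infinite past at time `0`. -/
abbrev Past : (ℤ → A) → (ℕ → A) := PastAt A 0

/-- `H[Future^L | Past] := inf_{M ≥ 1} H[Future^L | Past^M]`. -/
def condEntPast (μ : Measure (ℤ → A)) (L : ℕ) : ℝ :=
  ⨅ M : ℕ, condEnt μ (FutureBlk A L) (PastBlk A (M + 1))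

variable [Nontrivial A]

/-- The causal state at time `t`: the regular conditional distribution of the
future given the past, evaluated on the past at time `t`. -/
def causalState (μ : Measure (ℤ → A)) [IsFiniteMeasure μ] (t : ℤ) :
    (ℤ → A) → Measure (ℕ → A) :=
  fun ω => condDistrib (Future A) (Past A) μ (PastAt A t ω)

end

open scoped ENNReal

/-! ### Entropy as an extended nonnegative real -/

section Entropy

/-- The contribution `-p log₂ p` of an atom of probability `p` to the entropy. -/
noncomputable def entTerm (p : ℝ≥0∞) : ℝ≥0∞ :=
  ENNReal.ofReal (-(p.toReal * Real.logb 2 p.toReal))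

/-- Shannon entropy with values in `ℝ≥0∞`. -/
noncomputable def eent {Ω S : Type*} [MeasurableSpace Ω] (μ : Measure Ω) (U : Ω → S) : ℝ≥0∞ :=
  ∑' s : S, entTerm (μ (U ⁻¹' {s}))

/-- A map with countable range and measurable fibers. -/
structure IsDiscreteRV {Ω S : Type*} [MeasurableSpace Ω] (U : Ω → S) : Prop where
  countable : (Set.range U).Countable
  fiber : ∀ s, MeasurableSet (U ⁻¹' {s})

lemma preimage_pair {Ω S T : Type*} (U : Ω → S) (V : Ω → T) (z : S × T) :
    (fun ω => (U ω, V ω)) ⁻¹' {z} = U ⁻¹' {z.1} ∩ V ⁻¹' {z.2} := by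
  ext ω; simp [Prod.ext_iff]

lemma neg_toReal_mul_logb_nonneg {p : ℝ≥0∞} (hp : p ≤ 1) :
    0 ≤ -(p.toReal * Real.logb 2 p.toReal) := by
  have h1 : p.toReal ≤ 1 := ENNReal.toReal_le_of_le_ofReal zero_le_one (by simpa using hp)
  have := Real.logb_nonpos one_lt_two ENNReal.toReal_nonneg h1
  have := mul_nonneg (ENNReal.toReal_nonneg (a := p)) (neg_nonneg.2 this)
  linarith

@[simp] lemma entTerm_zero : entTerm 0 = 0 := by simp [entTerm]

lemma entTerm_mul {p q : ℝ≥0∞} (hp : p ≤ 1) (hq : q ≤ 1) :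
    entTerm (p * q) = p * entTerm q + q * entTerm p := by
  have hp' : p ≠ ∞ := ne_top_of_le_ne_top ENNReal.one_ne_top hp
  have hq' : q ≠ ∞ := ne_top_of_le_ne_top ENNReal.one_ne_top hq
  have h1 := neg_toReal_mul_logb_nonneg hp
  have h2 := neg_toReal_mul_logb_nonneg hq
  unfold entTerm
  conv_rhs => rw [← ENNReal.ofReal_toReal hp', ← ENNReal.ofReal_toReal hq']
  rw [ENNReal.toReal_ofReal ENNReal.toReal_nonneg, ENNReal.toReal_ofReal ENNReal.toReal_nonneg,
    ← ENNReal.ofReal_mul ENNReal.toReal_nonneg, ← ENNReal.ofReal_mul ENNReal.toReal_nonneg,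
    ← ENNReal.ofReal_add (mul_nonneg ENNReal.toReal_nonneg h2)
      (mul_nonneg ENNReal.toReal_nonneg h1), ENNReal.toReal_mul]
  congr 1
  rcases eq_or_ne p.toReal 0 with h | h
  · simp [h]
  rcases eq_or_ne q.toReal 0 with h' | h'
  · simp [h']
  rw [Real.logb_mul h h']
  ring

/-- Gibbs' inequality for one atom, against the reference mass `q * r`. -/
lemma entTerm_le {p q r : ℝ≥0∞} (hpq : p ≤ q) (hpr : p ≤ r) (hq : q ≤ 1) (hr : r ≤ 1) :
    entTerm p ≤ p * ENNReal.ofReal (-Real.logb 2 q.toReal)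
      + p * ENNReal.ofReal (-Real.logb 2 r.toReal)
      + ENNReal.ofReal (Real.log 2)⁻¹ * (q * r) := by
  rcases eq_or_ne p 0 with rfl | hp0
  · simp
  have hq' : q ≠ ∞ := ne_top_of_le_ne_top ENNReal.one_ne_top hq
  have hr' : r ≠ ∞ := ne_top_of_le_ne_top ENNReal.one_ne_top hr
  have hp' : p ≠ ∞ := ne_top_of_le_ne_top hq' hpq
  have hq1 : q.toReal ≤ 1 := ENNReal.toReal_le_of_le_ofReal zero_le_one (by simpa using hq)
  have hr1 : r.toReal ≤ 1 := ENNReal.toReal_le_of_le_ofReal zero_le_one (by simpa using hr)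
  have hpp : 0 < p.toReal := ENNReal.toReal_pos hp0 hp'
  have hqp : 0 < q.toReal := hpp.trans_le (ENNReal.toReal_mono hq' hpq)
  have hrp : 0 < r.toReal := hpp.trans_le (ENNReal.toReal_mono hr' hpr)
  have hlq : 0 ≤ -Real.logb 2 q.toReal := neg_nonneg.2 (Real.logb_nonpos one_lt_two hqp.le hq1)
  have hlr : 0 ≤ -Real.logb 2 r.toReal := neg_nonneg.2 (Real.logb_nonpos one_lt_two hrp.le hr1)
  have hl2 : 0 < Real.log 2 := Real.log_pos one_lt_two
  have hl2' : 0 ≤ (Real.log 2)⁻¹ := inv_nonneg.2 hl2.le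
  unfold entTerm
  conv_rhs => rw [← ENNReal.ofReal_toReal hp', ← ENNReal.ofReal_toReal hq',
    ← ENNReal.ofReal_toReal hr']
  rw [ENNReal.toReal_ofReal hqp.le, ENNReal.toReal_ofReal hrp.le,
    ← ENNReal.ofReal_mul hpp.le, ← ENNReal.ofReal_mul hpp.le, ← ENNReal.ofReal_mul hqp.le,
    ← ENNReal.ofReal_mul hl2', ← ENNReal.ofReal_add (by positivity) (by positivity),
    ← ENNReal.ofReal_add (by positivity) (by positivity)]
  apply ENNReal.ofReal_le_ofReal
  generalize p.toReal = x at *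
  generalize q.toReal = y at *
  generalize r.toReal = z at *
  have key : Real.log (y * z / x) ≤ y * z / x - 1 :=
    Real.log_le_sub_one_of_pos (by positivity)
  rw [Real.log_div (by positivity) hpp.ne', Real.log_mul hqp.ne' hrp.ne'] at key
  have key2 : x * (Real.log y + Real.log z - Real.log x) ≤ y * z := by
    calc _ ≤ x * (y * z / x - 1) := by gcongr
      _ = y * z - x := by field_simp
      _ ≤ _ := by linarith
  have key3 := mul_le_mul_of_nonneg_left key2 hl2'
  simp only [Real.logb, div_eq_inv_mul]
  linarith

variable {Ω S T : Type*} [MeasurableSpace Ω] {μ : Measure Ω}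

lemma ent_eq_toReal_eent [IsProbabilityMeasure μ] (U : Ω → S) :
    ent μ U = (eent μ U).toReal := by
  unfold ent eent entTerm
  rw [ENNReal.tsum_toReal_eq (fun _ => ENNReal.ofReal_ne_top)]
  exact tsum_congr fun s => (ENNReal.toReal_ofReal (neg_toReal_mul_logb_nonneg prob_le_one)).symm

lemma eent_ne_top_of_entSummable {U : Ω → S} (h : entSummable μ U) : eent μ U ≠ ∞ :=
  Summable.tsum_ofReal_ne_top h

lemma eent_equiv_comp (e : S ≃ T) (U : Ω → S) : eent μ (fun ω => e (U ω)) = eent μ U := by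
  unfold eent
  rw [← Equiv.tsum_eq e]
  refine tsum_congr fun s => ?_
  congr 2
  ext ω
  simp

namespace IsDiscreteRV

lemma pair {U : Ω → S} {V : Ω → T} (hU : IsDiscreteRV U) (hV : IsDiscreteRV V) :
    IsDiscreteRV (fun ω => (U ω, V ω)) where
  countable := (hU.countable.prod hV.countable).mono (by
    rintro _ ⟨ω, rfl⟩
    exact ⟨⟨ω, rfl⟩, ⟨ω, rfl⟩⟩)
  fiber z := by
    rw [preimage_pair]
    exact (hU.fiber _).inter (hV.fiber _)

lemma pi {ι : Type*} [Finite ι] {U : ι → Ω → S} (hU : ∀ i, IsDiscreteRV (U i)) :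
    IsDiscreteRV (fun ω i => U i ω) where
  countable := (Set.countable_univ_pi fun i => (hU i).countable).mono (by
    rintro _ ⟨ω, rfl⟩ i -
    exact ⟨ω, rfl⟩)
  fiber z := by
    have : (fun ω i => U i ω) ⁻¹' {z} = ⋂ i, U i ⁻¹' {z i} := by
      ext ω; simp [funext_iff]
    rw [this]
    exact MeasurableSet.iInter fun i => (hU i).fiber _

lemma tsum_measure_inter {U : Ω → S} (hU : IsDiscreteRV U) (E : Set Ω) :
    ∑' u, μ (U ⁻¹' {u} ∩ E) = μ E := by
  have h := tsum_measure_preimage_singleton (μ := μ.restrict E) hU.countable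
    (fun y _ => hU.fiber y)
  rw [Set.preimage_range, Measure.restrict_apply_univ] at h
  rw [← h, tsum_subtype (Set.range U) (fun b => μ.restrict E (U ⁻¹' {b}))]
  refine tsum_congr fun u => ?_
  by_cases hu : u ∈ Set.range U
  · rw [Set.indicator_of_mem hu, Measure.restrict_apply (hU.fiber u)]
  · rw [Set.indicator_of_notMem hu, Set.preimage_singleton_eq_empty.2 hu]
    simp

lemma tsum_measure {U : Ω → S} (hU : IsDiscreteRV U) : ∑' u, μ (U ⁻¹' {u}) = μ Set.univ := by
  simpa using hU.tsum_measure_inter (μ := μ) Set.univ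

end IsDiscreteRV

lemma tsum_measure_mul_logb [IsProbabilityMeasure μ] (U : Ω → S) :
    ∑' u, μ (U ⁻¹' {u}) * ENNReal.ofReal (-Real.logb 2 (μ (U ⁻¹' {u})).toReal) = eent μ U := by
  refine tsum_congr fun u => ?_
  conv_lhs => enter [1]; rw [← ENNReal.ofReal_toReal (measure_ne_top μ (U ⁻¹' {u}))]
  rw [← ENNReal.ofReal_mul ENNReal.toReal_nonneg, entTerm, mul_neg]

lemma eent_pair_ne_top [IsProbabilityMeasure μ] {U : Ω → S} {V : Ω → T}
    (hU : IsDiscreteRV U) (hV : IsDiscreteRV V) (hU' : eent μ U ≠ ∞) (hV' : eent μ V ≠ ∞) :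
    eent μ (fun ω => (U ω, V ω)) ≠ ∞ := by
  have hle : eent μ (fun ω => (U ω, V ω)) ≤
      eent μ U + eent μ V + ENNReal.ofReal (Real.log 2)⁻¹ := by
    calc eent μ (fun ω => (U ω, V ω))
        = ∑' (u : S) (v : T), entTerm (μ (U ⁻¹' {u} ∩ V ⁻¹' {v})) := by
          unfold eent
          simp_rw [preimage_pair]
          exact ENNReal.tsum_prod (f := fun u v => entTerm (μ (U ⁻¹' {u} ∩ V ⁻¹' {v})))
      _ ≤ ∑' (u : S) (v : T), (μ (U ⁻¹' {u} ∩ V ⁻¹' {v}) *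
            ENNReal.ofReal (-Real.logb 2 (μ (U ⁻¹' {u})).toReal)
          + μ (U ⁻¹' {u} ∩ V ⁻¹' {v}) * ENNReal.ofReal (-Real.logb 2 (μ (V ⁻¹' {v})).toReal)
          + ENNReal.ofReal (Real.log 2)⁻¹ * (μ (U ⁻¹' {u}) * μ (V ⁻¹' {v}))) := by
          gcongr with u v
          exact entTerm_le (measure_mono Set.inter_subset_left)
            (measure_mono Set.inter_subset_right) prob_le_one prob_le_one
      _ = _ := by
          simp_rw [ENNReal.tsum_add]
          congr 1
          · congr 1
            · simp_rw [ENNReal.tsum_mul_right, Set.inter_comm (U ⁻¹' _), hV.tsum_measure_inter]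
              exact tsum_measure_mul_logb U
            · rw [ENNReal.tsum_comm]
              simp_rw [ENNReal.tsum_mul_right, hU.tsum_measure_inter]
              exact tsum_measure_mul_logb V
          · simp_rw [ENNReal.tsum_mul_left, ENNReal.tsum_mul_right, hU.tsum_measure,
              hV.tsum_measure, measure_univ, mul_one]
  exact ne_top_of_le_ne_top (by finiteness) hle

lemma eent_pi_ne_top [IsProbabilityMeasure μ] (n : ℕ) (U : Fin n → Ω → S)
    (hU : ∀ i, IsDiscreteRV (U i)) (hU' : ∀ i, eent μ (U i) ≠ ∞) :
    eent μ (fun ω i => U i ω) ≠ ∞ := by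
  induction n with
  | zero =>
    rw [eent, tsum_fintype]
    exact (ENNReal.sum_lt_top.2 fun _ _ => ENNReal.ofReal_lt_top).ne
  | succ n ih =>
    have h := eent_equiv_comp (μ := μ) (Fin.consEquiv fun _ : Fin (n + 1) => S)
      (fun ω => (U 0 ω, fun i : Fin n => U i.succ ω))
    have h2 : (fun ω => Fin.consEquiv (fun _ : Fin (n + 1) => S)
        (U 0 ω, fun i : Fin n => U i.succ ω)) = fun ω i => U i ω := by
      funext ω
      exact Fin.cons_self_tail (fun i => U i ω)
    rw [h2] at h
    rw [h]
    exact eent_pair_ne_top (hU 0) (IsDiscreteRV.pi fun i => hU i.succ) (hU' 0)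
      (ih _ (fun i => hU _) (fun i => hU' _))

/-- The chain rule: the entropy of `(U, Z)` when `c z` is the law of `U` given `Z = z`. -/
lemma eent_pair_eq [IsProbabilityMeasure μ] {U : Ω → S} {Z : Ω → T}
    (hU : IsDiscreteRV U) (c : T → S → ℝ≥0∞) (hc : ∀ z s, c z s ≤ 1)
    (h : ∀ s z, μ (U ⁻¹' {s} ∩ Z ⁻¹' {z}) = c z s * μ (Z ⁻¹' {z})) :
    eent μ (fun ω => (U ω, Z ω)) =
      ∑' z, μ (Z ⁻¹' {z}) * ∑' s, entTerm (c z s) + eent μ Z := by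
  have hsum : ∀ z, (∑' s, c z s) * μ (Z ⁻¹' {z}) = μ (Z ⁻¹' {z}) := fun z => by
    rw [← ENNReal.tsum_mul_right]
    exact (tsum_congr fun s => (h s z).symm).trans (hU.tsum_measure_inter (Z ⁻¹' {z}))
  calc eent μ (fun ω => (U ω, Z ω))
      = ∑' (s : S) (z : T), entTerm (μ (U ⁻¹' {s} ∩ Z ⁻¹' {z})) := by
        unfold eent
        simp_rw [preimage_pair]
        exact ENNReal.tsum_prod (f := fun s z => entTerm (μ (U ⁻¹' {s} ∩ Z ⁻¹' {z})))
    _ = ∑' (z : T), ∑' (s : S), (c z s * entTerm (μ (Z ⁻¹' {z}))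
          + μ (Z ⁻¹' {z}) * entTerm (c z s)) := by
        rw [ENNReal.tsum_comm]
        simp_rw [h, entTerm_mul (hc _ _) prob_le_one]
    _ = _ := by
        unfold eent
        rw [← ENNReal.tsum_add]
        refine tsum_congr fun z => ?_
        rw [ENNReal.tsum_add, ENNReal.tsum_mul_left, ENNReal.tsum_mul_right, add_comm]
        congr 1
        rcases eq_or_ne (μ (Z ⁻¹' {z})) 0 with h0 | h0
        · simp [h0]
        · have : ∑' s, c z s = 1 := by
            have := hsum z
            rwa [ENNReal.mul_eq_right h0 (measure_ne_top _ _)] at this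
          rw [this, one_mul]

/-- If `U` and `W` are conditionally independent given `V`, then `H[U|V,W] = H[U|V]`. -/
lemma condEnt_pair_eq_of_condIndep [IsProbabilityMeasure μ] {R : Type*} {U : Ω → S} {V : Ω → T}
    {W : Ω → R} (hU : IsDiscreteRV U) (hV : IsDiscreteRV V) (hW : IsDiscreteRV W)
    (hU' : eent μ U ≠ ∞) (hV' : eent μ V ≠ ∞) (hW' : eent μ W ≠ ∞)
    (c : T → S → ℝ≥0∞) (hc : ∀ v u, c v u ≤ 1)
    (h : ∀ u v w, μ (U ⁻¹' {u} ∩ (V ⁻¹' {v} ∩ W ⁻¹' {w})) =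
      c v u * μ (V ⁻¹' {v} ∩ W ⁻¹' {w})) :
    condEnt μ U (fun ω => (V ω, W ω)) = condEnt μ U V := by
  have h1 := eent_pair_eq (μ := μ) (Z := fun ω => (V ω, W ω)) hU (fun z => c z.1)
    (fun z => hc z.1) (fun s z => by simpa only [preimage_pair] using h s z.1 z.2)
  have h2 := eent_pair_eq (μ := μ) (Z := V) hU c hc (fun u v => by
    rw [← hW.tsum_measure_inter (U ⁻¹' {u} ∩ V ⁻¹' {v}), ← hW.tsum_measure_inter (V ⁻¹' {v}),
      ← ENNReal.tsum_mul_left]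
    refine tsum_congr fun w => ?_
    rw [Set.inter_comm (W ⁻¹' _), Set.inter_assoc, h, Set.inter_comm (W ⁻¹' _)])
  have h3 : ∑' z : T × R, μ ((fun ω => (V ω, W ω)) ⁻¹' {z}) * ∑' s, entTerm (c z.1 s) =
      ∑' v, μ (V ⁻¹' {v}) * ∑' s, entTerm (c v s) := by
    simp_rw [preimage_pair]
    rw [ENNReal.tsum_prod (f := fun v w => μ (V ⁻¹' {v} ∩ W ⁻¹' {w}) * ∑' s, entTerm (c v s))]
    refine tsum_congr fun v => ?_
    simp_rw [ENNReal.tsum_mul_right, Set.inter_comm (V ⁻¹' _), hW.tsum_measure_inter]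
  rw [h3] at h1
  have hUV := eent_pair_ne_top hU hV hU' hV'
  have hK := ne_top_of_le_ne_top hUV (h2 ▸ le_self_add)
  unfold condEnt
  simp_rw [ent_eq_toReal_eent]
  rw [h1, h2, ENNReal.toReal_add hK (eent_pair_ne_top hV hW hV' hW'), ENNReal.toReal_add hK hV']
  ring

end Entropy

/-! ### Stationary processes and unifilarity of causal states -/

lemma ProbabilityTheory.Kernel.measurableSet_setOf_eq {α γ : Type*} [MeasurableSpace α]
    [MeasurableSpace γ] [MeasurableSpace.CountableOrCountablyGenerated α γ]
    (κ η : Kernel α γ) [IsFiniteKernel κ] [IsFiniteKernel η] :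
    MeasurableSet {a | κ a = η a} := by
  have h : {a | κ a = η a} = {a | κ a ≪ η a} ∩
      {a | η a (Prod.mk a ⁻¹' {x | κ.rnDeriv η x.1 x.2 = 1}ᶜ) = 0} := by
    ext a
    constructor
    · intro (h : κ a = η a)
      have h_ac : κ a ≪ η a := h ▸ Measure.AbsolutelyContinuous.rfl
      exact ⟨h_ac, (Kernel.rnDeriv_eq_one_iff_eq h_ac).2 h⟩
    · rintro ⟨h_ac, h⟩
      exact (Kernel.rnDeriv_eq_one_iff_eq h_ac).1 h
  rw [h]
  refine (Kernel.measurableSet_absolutelyContinuous κ η).inter ?_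
  refine Kernel.measurable_kernel_prodMk_left ?_ (measurableSet_singleton 0)
  exact ((Kernel.measurable_rnDeriv κ η) (measurableSet_singleton 1)).compl

section CausalStates

/-- Prepend a symbol to a sequence. -/
def seqCons {A : Type*} (a : A) (p : ℕ → A) : ℕ → A
  | 0 => a
  | n + 1 => p n

variable {A : Type*}

lemma PastAt_shift (t : ℤ) (ω : ℤ → A) : PastAt A t (shift A ω) = PastAt A (t + 1) ω := by
  funext n
  simp only [PastAt, shift]
  congr 1
  ring

lemma PastAt_one (ω : ℤ → A) : PastAt A 1 ω = seqCons (ω 0) (Past A ω) := by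
  funext n
  cases n with
  | zero => simp [PastAt, seqCons]
  | succ n =>
    simp only [PastAt, seqCons]
    congr 1
    push_cast
    ring

lemma Future_eq_seqCons (ω : ℤ → A) :
    Future A ω = seqCons (ω 0) (Future A (shift A ω)) := by
  funext n
  cases n with
  | zero => simp [Future, seqCons]
  | succ n => simp [Future, seqCons, shift]

/-- Every past at time `-n` is a function of the past at time `0`. -/
lemma PastAt_neg (n : ℕ) (ω : ℤ → A) :
    PastAt A (-(n : ℤ)) ω = fun m => Past A ω (m + n) := by
  funext m
  simp only [PastAt]
  congr 1
  push_cast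
  ring

lemma PastAt_surjective (t : ℤ) : Function.Surjective (PastAt A t) := by
  intro p
  refine ⟨fun s => p (t - 1 - s).toNat, ?_⟩
  funext n
  simp [PastAt]

variable [MeasurableSpace A]

lemma measurable_seqCons : Measurable (fun q : A × (ℕ → A) => seqCons q.1 q.2) := by
  refine measurable_pi_iff.2 fun n => ?_
  cases n with
  | zero => exact measurable_fst
  | succ n => exact (measurable_pi_apply n).comp measurable_snd

lemma Measurable.seqCons {α : Type*} [MeasurableSpace α] {f : α → A} {g : α → ℕ → A}
    (hf : Measurable f) (hg : Measurable g) : Measurable fun x => seqCons (f x) (g x) :=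
  measurable_seqCons.comp (hf.prodMk hg)

lemma measurable_shift : Measurable (shift A) :=
  measurable_pi_iff.2 fun _ => measurable_pi_apply _

lemma measurable_Future : Measurable (Future A) :=
  measurable_pi_iff.2 fun _ => measurable_pi_apply _

lemma measurable_PastAt (t : ℤ) : Measurable (PastAt A t) :=
  measurable_pi_iff.2 fun _ => measurable_pi_apply _

variable [Fintype A] [MeasurableSingletonClass A] [Nontrivial A]
  {μ : Measure (ℤ → A)} [IsProbabilityMeasure μ]

lemma causalState_shift (t : ℤ) (ω : ℤ → A) :
    causalState A μ t (shift A ω) = causalState A μ (t + 1) ω := by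
  simp only [causalState, PastAt_shift]

lemma range_causalState (t : ℤ) :
    Set.range (causalState A μ t) = Set.range (condDistrib (Future A) (Past A) μ) :=
  (PastAt_surjective t).range_comp (condDistrib (Future A) (Past A) μ)

lemma measurableSet_condDistrib_eq (ν : Measure (ℕ → A)) :
    MeasurableSet {p | condDistrib (Future A) (Past A) μ p = ν} := by
  by_cases hν : IsFiniteMeasure ν
  · exact Kernel.measurableSet_setOf_eq _ (Kernel.const _ ν)
  · convert MeasurableSet.empty
    ext p
    simp only [Set.mem_ofPred_eq, Set.mem_empty_iff_false, iff_false]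
    rintro rfl
    exact hν inferInstance

lemma isDiscreteRV_causalState (hcount : (Set.range (causalState A μ 0)).Countable) (t : ℤ) :
    IsDiscreteRV (causalState A μ t) where
  countable := by rwa [range_causalState, ← range_causalState 0]
  fiber ν := (measurable_PastAt t) (measurableSet_condDistrib_eq ν)

lemma eent_causalState_add_one (hstat : μ.map (shift A) = μ)
    (hcount : (Set.range (causalState A μ 0)).Countable) (t : ℤ) :
    eent μ (causalState A μ (t + 1)) = eent μ (causalState A μ t) := by
  refine tsum_congr fun ν => ?_
  have h := (MeasurePreserving.mk measurable_shift hstat).measure_preimage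
    ((isDiscreteRV_causalState hcount t).fiber ν).nullMeasurableSet
  rw [← h, ← Set.preimage_comp]
  congr 3
  funext ω
  exact (causalState_shift t ω).symm

lemma eent_causalState (hstat : μ.map (shift A) = μ)
    (hcount : (Set.range (causalState A μ 0)).Countable) (t : ℤ) :
    eent μ (causalState A μ t) = eent μ (causalState A μ 0) := by
  induction t with
  | zero => rfl
  | succ n ih => rw [eent_causalState_add_one hstat hcount, ih]
  | pred n ih =>
    rw [← ih, ← eent_causalState_add_one hstat hcount, sub_add_cancel]

lemma lintegral_condDistrib_Past {G : (ℕ → A) × (ℕ → A) → ℝ≥0∞} (hG : Measurable G) :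
    ∫⁻ ω, ∫⁻ x, G (Past A ω, x) ∂(condDistrib (Future A) (Past A) μ (Past A ω)) ∂μ =
      ∫⁻ ω, G (Past A ω, Future A ω) ∂μ := by
  have h : μ.map (Past A) ⊗ₘ condDistrib (Future A) (Past A) μ =
      μ.map (fun ω => (Past A ω, Future A ω)) :=
    compProd_map_condDistrib measurable_Future.aemeasurable
  have h2 := congrArg (fun m => ∫⁻ z, G z ∂m) h
  rw [Measure.lintegral_compProd hG, lintegral_map hG
    ((measurable_PastAt 0).prodMk measurable_Future), lintegral_map
    hG.lintegral_kernel_prod_right' (measurable_PastAt 0)] at h2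
  exact h2

lemma lintegral_condDistrib_PastAt_one (hstat : μ.map (shift A) = μ)
    {G : (ℕ → A) × (ℕ → A) → ℝ≥0∞} (hG : Measurable G) :
    ∫⁻ ω, ∫⁻ x, G (PastAt A 1 ω, x) ∂(condDistrib (Future A) (Past A) μ (PastAt A 1 ω)) ∂μ =
      ∫⁻ ω, G (PastAt A 1 ω, Future A (shift A ω)) ∂μ := by
  have h := lintegral_condDistrib_Past (μ := μ) hG
  have h0 : Measurable fun p => ∫⁻ x, G (p, x) ∂(condDistrib (Future A) (Past A) μ p) :=
    hG.lintegral_kernel_prod_right'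
  have hl := lintegral_map (μ := μ) (h0.comp (measurable_PastAt 0)) measurable_shift
  have hr := lintegral_map (μ := μ)
    (hG.comp ((measurable_PastAt 0).prodMk measurable_Future)) measurable_shift
  rw [hstat] at hl hr
  simp only [Function.comp_apply, PastAt_shift, zero_add] at hl hr
  rw [← hl, ← hr]
  exact h

/-- Unifilarity: given the causal state `ν` of a past `p`, the causal state of the past extended by
the symbol `a` is the conditional law under `ν` of the remaining symbols given the first. -/
lemma ae_condDistrib_eq (hstat : μ.map (shift A) = μ) :
    ∀ᵐ p ∂(μ.map (Past A)), ∀ (a : A) (B : Set (ℕ → A)), MeasurableSet B →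
      condDistrib (Future A) (Past A) μ p {x | x 0 = a ∧ (fun n => x (n + 1)) ∈ B} =
        condDistrib (Future A) (Past A) μ p {x | x 0 = a} *
          condDistrib (Future A) (Past A) μ (seqCons a p) B := by
  set κ := condDistrib (Future A) (Past A) μ with hκ
  have hhead : Measurable fun x : ℕ → A => x 0 := measurable_pi_apply 0
  have htail : Measurable fun (x : ℕ → A) n => x (n + 1) :=
    measurable_pi_iff.2 fun n => measurable_pi_apply _
  have hcons : Measurable fun z : (ℕ → A) × A => seqCons z.2 z.1 :=
    measurable_snd.seqCons measurable_fst
  let ξ : Kernel ((ℕ → A) × A) (ℕ → A) := κ.comap _ hcons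
  let κ' : Kernel (ℕ → A) (ℕ → A) :=
    ((κ.map fun x => x 0) ⊗ₖ ξ).map fun q => seqCons q.1 q.2
  have : IsMarkovKernel (κ.map fun x => x 0) := Kernel.IsMarkovKernel.map _ hhead
  have : IsMarkovKernel κ' := Kernel.IsMarkovKernel.map _ measurable_seqCons
  have key : μ.map (fun ω => (Past A ω, Future A ω)) = μ.map (Past A) ⊗ₘ κ' := by
    refine Measure.ext_of_lintegral _ fun f hf => ?_
    have hH : Measurable fun z : (ℕ → A) × (ℕ → A) =>
        ∫⁻ y, f (z.1, seqCons (z.2 0) y) ∂(κ (seqCons (z.2 0) z.1)) := by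
      have hc : Measurable fun z : (ℕ → A) × (ℕ → A) => seqCons (z.2 0) z.1 :=
        (hhead.comp measurable_snd).seqCons measurable_fst
      exact Measurable.lintegral_kernel_prod_right' (κ := κ.comap _ hc)
        (f := fun w : ((ℕ → A) × (ℕ → A)) × (ℕ → A) => f (w.1.1, seqCons (w.1.2 0) w.2))
        (hf.comp ((measurable_fst.comp measurable_fst).prodMk
          ((hhead.comp (measurable_snd.comp measurable_fst)).seqCons measurable_snd)))
    have hG : Measurable fun z : (ℕ → A) × (ℕ → A) =>
        f ((fun n => z.1 (n + 1)), seqCons (z.1 0) z.2) :=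
      hf.comp ((htail.comp measurable_fst).prodMk
        ((hhead.comp measurable_fst).seqCons measurable_snd))
    have h1 := lintegral_condDistrib_Past (μ := μ) hH
    have h2 := lintegral_condDistrib_PastAt_one hstat hG
    simp only [PastAt_one, seqCons, ← Future_eq_seqCons, ← hκ] at h1 h2
    rw [lintegral_map hf ((measurable_PastAt 0).prodMk measurable_Future),
      Measure.lintegral_compProd hf,
      lintegral_map hf.lintegral_kernel_prod_right' (measurable_PastAt 0), ← h2]
    refine Eq.trans ?_ (h1.symm.trans ?_)
    · simp only [Future]
      rfl
    · refine lintegral_congr fun ω => ?_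
      have hfp : Measurable fun x => f (Past A ω, x) := hf.comp measurable_prodMk_left
      have hg : Measurable fun q : A × (ℕ → A) => f (Past A ω, seqCons q.1 q.2) :=
        hfp.comp measurable_seqCons
      rw [Kernel.lintegral_map _ measurable_seqCons _ hfp, Kernel.lintegral_compProd _ _ _ hg]
      exact (Kernel.lintegral_map κ hhead _ (Measurable.lintegral_kernel_prod_right'
        (κ := ξ.comap (Prod.mk (Past A ω)) measurable_prodMk_left) hg)).symm
  have hae := condDistrib_ae_eq_of_measure_eq_compProd (Past A)
    measurable_Future.aemeasurable key
  filter_upwards [hae] with p hp a B hB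
  have hE : MeasurableSet {x : ℕ → A | x 0 = a ∧ (fun n => x (n + 1)) ∈ B} :=
    (hhead (measurableSet_singleton a)).inter (htail hB)
  rw [← hκ] at hp
  conv_lhs => rw [hp]
  have hpre : (fun q : A × (ℕ → A) => seqCons q.1 q.2) ⁻¹'
      {x : ℕ → A | x 0 = a ∧ (fun n => x (n + 1)) ∈ B} = {a} ×ˢ B := by
    ext q
    simp [seqCons]
  rw [Kernel.map_apply' _ measurable_seqCons _ hE, hpre,
    Kernel.compProd_apply_prod (measurableSet_singleton a) hB, lintegral_singleton,
    Kernel.map_apply' _ hhead _ (measurableSet_singleton a), mul_comm]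
  rfl

/-- The conditional law of the next causal state given the past depends on the past only through
the current causal state. -/
lemma exists_causalState_transition (hstat : μ.map (shift A) = μ)
    (s r : Measure (ℕ → A)) :
    ∃ c : ℝ≥0∞, c ≤ 1 ∧ ∀ B : Set (ℕ → A), MeasurableSet B →
      μ (causalState A μ 1 ⁻¹' {s} ∩ (causalState A μ 0 ⁻¹' {r} ∩ Past A ⁻¹' B)) =
        c * μ (causalState A μ 0 ⁻¹' {r} ∩ Past A ⁻¹' B) := by
  have hae := ae_condDistrib_eq hstat
  set κ := condDistrib (Future A) (Past A) μ with hκ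
  have hconst : ∃ c : ℝ≥0∞, c ≤ 1 ∧ ∀ᵐ p ∂(μ.map (Past A)), κ p = r →
      κ p {x | κ (seqCons (x 0) p) = s} = c := by
    by_cases hex : ∃ p₀, κ p₀ = r ∧ ∀ (a : A) (B : Set (ℕ → A)), MeasurableSet B →
        κ p₀ {x | x 0 = a ∧ (fun n => x (n + 1)) ∈ B} =
          κ p₀ {x | x 0 = a} * κ (seqCons a p₀) B
    · obtain ⟨p₀, hp₀, hgood₀⟩ := hex
      refine ⟨κ p₀ {x | κ (seqCons (x 0) p₀) = s}, prob_le_one, ?_⟩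
      filter_upwards [hae] with p hgood hp
      rw [hp₀] at hgood₀ ⊢
      rw [hp] at hgood ⊢
      have : IsProbabilityMeasure r := hp ▸ inferInstance
      have hpos : ∀ᵐ x ∂r, ∀ a, r {y | y 0 = a} = 0 → x 0 ≠ a := by
        refine ae_all_iff.2 fun a => ?_
        by_cases ha : r {y | y 0 = a} = 0
        · filter_upwards [measure_eq_zero_iff_ae_notMem.1 ha] with x hx _ using hx
        · simp [ha]
      refine measure_congr ?_
      filter_upwards [hpos] with x hx
      have hx0 : r {y | y 0 = x 0} ≠ 0 := fun h => hx _ h rfl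
      have heq : κ (seqCons (x 0) p) = κ (seqCons (x 0) p₀) := by
        refine Measure.ext fun B hB => ?_
        have h := (hgood (x 0) B hB).symm.trans (hgood₀ (x 0) B hB)
        exact (ENNReal.mul_right_inj hx0 (measure_ne_top r _)).1 h
      change (κ (seqCons (x 0) p) = s) = (κ (seqCons (x 0) p₀) = s)
      rw [heq]
    · refine ⟨0, zero_le_one, ?_⟩
      filter_upwards [hae] with p hgood hp
      exact absurd ⟨p, hp, hgood⟩ hex
  obtain ⟨c, hc, hconst⟩ := hconst
  refine ⟨c, hc, fun B hB => ?_⟩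
  have hmeas : ∀ ν, MeasurableSet {p | κ p = ν} := measurableSet_condDistrib_eq
  have hC : MeasurableSet ({p | κ p = r} ∩ B) := (hmeas r).inter hB
  have hnext : Measurable fun z : (ℕ → A) × (ℕ → A) => seqCons (z.2 0) z.1 :=
    ((measurable_pi_apply 0).comp measurable_snd).seqCons measurable_fst
  have hD : MeasurableSet {z : (ℕ → A) × (ℕ → A) |
      κ (seqCons (z.2 0) z.1) = s ∧ z.1 ∈ {p | κ p = r} ∩ B} :=
    (hnext (hmeas s)).inter (measurable_fst hC)
  have h := lintegral_condDistrib_Past (μ := μ) (measurable_one.indicator hD)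
  have hlhs : ∀ᵐ ω ∂μ, ∫⁻ x, Set.indicator {z : (ℕ → A) × (ℕ → A) |
      κ (seqCons (z.2 0) z.1) = s ∧ z.1 ∈ {p | κ p = r} ∩ B} 1 (Past A ω, x) ∂(κ (Past A ω)) =
      Set.indicator (Past A ⁻¹' ({p | κ p = r} ∩ B)) (fun _ => c) ω := by
    filter_upwards [ae_of_ae_map (measurable_PastAt 0).aemeasurable hconst] with ω hω
    have h1 := lintegral_indicator_one (μ := κ (Past A ω))
      (measurable_prodMk_left (x := Past A ω) hD)
    refine h1.trans ?_
    by_cases hmem : Past A ω ∈ {p | κ p = r} ∩ B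
    · rw [Set.indicator_of_mem (by exact hmem), ← hω hmem.1]
      congr 1
      ext x
      exact and_iff_left hmem
    · rw [Set.indicator_of_notMem (by exact hmem)]
      convert measure_empty (μ := κ (Past A ω))
      ext x
      exact iff_of_false (fun hx => hmem hx.2) (Set.notMem_empty x)
  rw [← hκ, lintegral_congr_ae hlhs,
    lintegral_indicator_const ((measurable_PastAt 0) hC)] at h
  have hrhs := lintegral_indicator_one (μ := μ)
    (((measurable_PastAt 0).prodMk measurable_Future) hD)
  refine Eq.trans ?_ ((h.trans hrhs).symm)
  congr 1
  ext ω
  simp only [Set.mem_inter_iff, Set.mem_preimage, Set.mem_singleton_iff, causalState, PastAt_one,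
    ← hκ]
  rfl

end CausalStates

/-- the causal-state process is Markov: conditioning further on
`S_{-1}, …, S_{-k}` beyond `S_0` does not reduce the uncertainty of `S_1`. -/
theorem causal_states_markov
    {A : Type*} [Fintype A] [Nontrivial A] [MeasurableSpace A] [MeasurableSingletonClass A]
    (μ : Measure (ℤ → A)) [IsProbabilityMeasure μ]
    (hstat : μ.map (shift A) = μ)
    (hcount : (Set.range (causalState A μ 0)).Countable)
    (hfin : entSummable μ (causalState A μ 0))
    (k : ℕ) (hk : 1 ≤ k) :
    condEnt μ (causalState A μ 1)
        (fun ω => (causalState A μ 0 ω,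
          fun i : Fin k => causalState A μ (-((i : ℕ) : ℤ) - 1) ω)) =
      condEnt μ (causalState A μ 1) (causalState A μ 0) := by
  choose c hc h using fun r s => exists_causalState_transition hstat s r
  have hdisc := fun t => isDiscreteRV_causalState hcount t
  have hent : ∀ t, eent μ (causalState A μ t) ≠ ∞ := fun t => by
    rw [eent_causalState hstat hcount]
    exact eent_ne_top_of_entSummable hfin
  have hdrop : ∀ n : ℕ, Measurable fun (p : ℕ → A) m => p (m + n) := fun n =>
    measurable_pi_iff.2 fun m => measurable_pi_apply _
  have hidx : ∀ i : Fin k, (-((i : ℕ) : ℤ) - 1) = -((i + 1 : ℕ) : ℤ) := fun i => by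
    push_cast
    ring
  refine condEnt_pair_eq_of_condIndep (hdisc 1) (hdisc 0) (IsDiscreteRV.pi fun i => hdisc _)
    (hent 1) (hent 0) (eent_pi_ne_top k _ (fun i => hdisc _) (fun i => hent _)) c hc
    fun s r w => ?_
  have hW : (fun ω (i : Fin k) => causalState A μ (-((i : ℕ) : ℤ) - 1) ω) ⁻¹' {w} =
      Past A ⁻¹' ⋂ i : Fin k, (fun p m => p (m + ((i : ℕ) + 1))) ⁻¹'
        {p | condDistrib (Future A) (Past A) μ p = w i} := by
    ext ω
    simp only [Set.mem_preimage, Set.mem_singleton_iff, Set.mem_iInter, Set.mem_ofPred_eq,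
      funext_iff, causalState, hidx, PastAt_neg]
  rw [hW]
  exact h r s _ (MeasurableSet.iInter fun i => hdrop _ (measurableSet_condDistrib_eq _))
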